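/- Let ι be a nonempty finite set, s_min > 0, and let p, q be probability mass functions on ι with q(i) ≥ s_min for every i ∈ ι. Then KL(p‖q) ≤ 2·TV(p,q)²/s_min, where TV(p,q) := sup_{A ⊆ ι} |Σ_{i∈A}(p(i) − q(i))|. -/

import Mathlib

open Finset

/-- Total variation distance between two functions (pmfs) on a finite type:
`sup_{A ⊆ ι} |∑_{i∈A} (p i − q i)|`. -/
noncomputable def tvDist {ι : Type*} [Fintype ι] (p q : ι → ℝ) : ℝ :=
  ⨆ A : Finset ι, |∑ i ∈ A, (p i - q i)|

/-- Kullback–Leibler divergence between two pmfs on a finite type: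
`∑_i p i · log (p i / q i)`. -/
noncomputable def klFin {ι : Type*} [Fintype ι] (p q : ι → ℝ) : ℝ :=
  ∑ i, p i * Real.log (p i / q i)

theorem abs_sum_sub_le_tvDist {ι : Type*} [Fintype ι] (p q : ι → ℝ) (A : Finset ι) :
    |∑ i ∈ A, (p i - q i)| ≤ tvDist p q :=
  le_ciSup (f := fun A : Finset ι => |∑ i ∈ A, (p i - q i)|) (Set.finite_range _).bddAbove A

theorem sum_abs_sub_le_two_mul_tvDist {ι : Type*} [Fintype ι] (p q : ι → ℝ) :
    ∑ i, |p i - q i| ≤ 2 * tvDist p q := by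
  rw [← sum_filter_add_sum_filter_not univ (fun i => 0 ≤ p i - q i)]
  have hpos : ∑ i with 0 ≤ p i - q i, |p i - q i| = ∑ i with 0 ≤ p i - q i, (p i - q i) :=
    sum_congr rfl fun i hi => abs_of_nonneg (mem_filter.mp hi).2
  have hneg : ∑ i with ¬0 ≤ p i - q i, |p i - q i| =
      -∑ i with ¬0 ≤ p i - q i, (p i - q i) := by
    rw [← sum_neg_distrib]
    exact sum_congr rfl fun i hi => abs_of_neg (not_le.mp (mem_filter.mp hi).2)
  rw [hpos, hneg, two_mul]
  exact add_le_add ((le_abs_self _).trans (abs_sum_sub_le_tvDist p q _))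
    ((neg_le_abs _).trans (abs_sum_sub_le_tvDist p q _))

theorem sum_sq_sub_le_two_mul_tvDist_sq {ι : Type*} [Fintype ι] (p q : ι → ℝ) :
    ∑ i, (p i - q i) ^ 2 ≤ 2 * tvDist p q ^ 2 := by
  have hnonneg : 0 ≤ tvDist p q := (abs_nonneg _).trans (abs_sum_sub_le_tvDist p q ∅)
  calc ∑ i, (p i - q i) ^ 2 ≤ ∑ i, tvDist p q * |p i - q i| := by
        refine sum_le_sum fun i _ => ?_
        rw [← sq_abs, sq]
        refine mul_le_mul_of_nonneg_right ?_ (abs_nonneg _)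
        simpa using abs_sum_sub_le_tvDist p q {i}
    _ = tvDist p q * ∑ i, |p i - q i| := (mul_sum _ _ _).symm
    _ ≤ tvDist p q * (2 * tvDist p q) :=
        mul_le_mul_of_nonneg_left (sum_abs_sub_le_two_mul_tvDist p q) hnonneg
    _ = 2 * tvDist p q ^ 2 := by ring

theorem mul_log_div_le_sub_add_sq_div {x y : ℝ} (hx : 0 ≤ x) (hy : 0 < y) :
    x * Real.log (x / y) ≤ (x - y) + (x - y) ^ 2 / y := by
  have hlog : x * Real.log (x / y) ≤ x * (x / y - 1) := by
    rcases hx.eq_or_lt with rfl | hx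
    · simp
    · exact mul_le_mul_of_nonneg_left (Real.log_le_sub_one_of_pos (div_pos hx hy)) hx.le
  refine hlog.trans_eq ?_
  field_simp
  ring

/-- reverse-Pinsker-type inequality. If `q ≥ s_min > 0` pointwise, then
`KL(p‖q) ≤ 2·TV(p,q)²/s_min`. -/
theorem stmt5 {ι : Type*} [Fintype ι] [Nonempty ι]
    (smin : ℝ) (hsmin : 0 < smin)
    (p q : ι → ℝ)
    (hp0 : ∀ i, 0 ≤ p i) (hp1 : ∑ i, p i = 1)
    (hq0 : ∀ i, 0 ≤ q i) (hq1 : ∑ i, q i = 1)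
    (hq : ∀ i, smin ≤ q i) :
    klFin p q ≤ 2 * (tvDist p q) ^ 2 / smin := by
  calc klFin p q ≤ ∑ i, ((p i - q i) + (p i - q i) ^ 2 / smin) := by
        refine sum_le_sum fun i _ => ?_
        refine (mul_log_div_le_sub_add_sq_div (hp0 i) (hsmin.trans_le (hq i))).trans ?_
        gcongr
        exact hq i
    _ = (∑ i, (p i - q i) ^ 2) / smin := by
        rw [sum_add_distrib, sum_sub_distrib, hp1, hq1, sub_self, zero_add, sum_div]
    _ ≤ 2 * tvDist p q ^ 2 / smin := by
        gcongr
        exact sum_sq_sub_le_two_mul_tvDist_sq p q
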